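/- Let X be a CAT(0) cube complex with no extremal vertices. Two points x, y ∈ ∂X are the two endpoints at infinity of a straight bi-infinite geodesic line if and only if both of the following hold: (1) I(x,y) ∩ X ≠ ∅; (2) there do not exist points z, w ∈ ∂X and a,b,c ∈ ℕ ∪ {+∞} with crt(x,y,z,w) = ⟪a:b:c⟫ and a < min{b,c} < +∞. -/

import Mathlib

/-!
We use the standard combinatorial model of a CAT(0) cube complex: it is identified
with its vertex set endowed with the combinatorial (ℓ¹) metric, i.e. with a median
graph `G` on a vertex type `V`.  Halfspaces are realised as the vertex sets of the
two sides of the hyperplane dual to an edge, the Roller compactification `X̄` is the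
set of ultrafilters of halfspaces, vertices embedding via principal ultrafilters,
and the Roller boundary `∂X` consists of the non-principal ultrafilters.
-/

open scoped ENNReal
open Set

namespace CCCR

variable {V V' : Type*}

/-- The interval between two vertices w.r.t. the combinatorial metric. -/
def vInterval (G : SimpleGraph V) (u v : V) : Set V :=
  {w : V | G.dist u w + G.dist w v = G.dist u v}

/-- Combinatorial model of a CAT(0) cube complex (identified with its vertex set,
endowed with the combinatorial metric): a connected median graph. -/
def IsCCC (G : SimpleGraph V) : Prop :=
  G.Connected ∧ ∀ x y z : V, ∃! m : V,
    m ∈ vInterval G x y ∧ m ∈ vInterval G y z ∧ m ∈ vInterval G z x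

/-- Halfspaces of the cube complex: the sides of the hyperplane dual to an edge. -/
def IsHalfspace (G : SimpleGraph V) (h : Set V) : Prop :=
  ∃ u v : V, G.Adj u v ∧ h = {w : V | G.dist w v < G.dist w u}

/-- The halfspace dual to the (oriented) edge `(u,v)` containing `v`. -/
def edgeHalf (G : SimpleGraph V) (u v : V) : Set V :=
  {w : V | G.dist w v < G.dist w u}

/-- The hyperplane (wall) dual to the edge `(u,v)`, recorded as its pair of sides. -/
def wallOf (G : SimpleGraph V) (u v : V) : Set (Set V) :=
  {edgeHalf G u v, (edgeHalf G u v)ᶜ}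

/-- Two (necessarily distinct) hyperplanes, with respective sides `h` and `k`,
are transverse: all four quarter-spaces are nonempty. -/
def Transv (h k : Set V) : Prop :=
  (h ∩ k).Nonempty ∧ (h ∩ kᶜ).Nonempty ∧ (hᶜ ∩ k).Nonempty ∧ (hᶜ ∩ kᶜ).Nonempty

/-- An ultrafilter of halfspaces: a point of the Roller compactification X̄.
It contains exactly one side of each hyperplane, and any two members intersect. -/
def IsUltra (G : SimpleGraph V) (σ : Set (Set V)) : Prop :=
  (∀ h ∈ σ, IsHalfspace G h) ∧
  (∀ h : Set V, IsHalfspace G h → (h ∈ σ ↔ hᶜ ∉ σ)) ∧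
  (∀ h ∈ σ, ∀ k ∈ σ, (h ∩ k).Nonempty)

/-- The principal ultrafilter of a vertex, i.e. the image of `v` in X̄. -/
def princ (G : SimpleGraph V) (v : V) : Set (Set V) :=
  {h : Set V | IsHalfspace G h ∧ v ∈ h}

/-- A point of the Roller boundary ∂X = X̄ ∖ X: a non-principal ultrafilter. -/
def IsBdryPt (G : SimpleGraph V) (σ : Set (Set V)) : Prop :=
  IsUltra G σ ∧ ∀ v : V, σ ≠ princ G v

/-- The Roller boundary ∂X as a type. -/
abbrev Bdry (G : SimpleGraph V) : Type _ := {σ : Set (Set V) // IsBdryPt G σ}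

/-- The Gromov product (x·y)_v = #𝒲(v | x, y) ∈ ℕ ∪ {+∞}, counted through the
sides containing both x and y but not v. -/
noncomputable def grom (_G : SimpleGraph V) (v : V) (x y : Set (Set V)) : ℕ∞ :=
  {h : Set V | h ∈ x ∧ h ∈ y ∧ v ∉ h}.encard

/-- The embedding ℕ ∪ {+∞} → ℤ ∪ {±∞}. -/
noncomputable def toE (n : ℕ∞) : EReal := ((n : ℝ≥0∞) : EReal)

/-- The cross ratio cr_v(x,y,z,w) = (x·z)_v + (y·w)_v − (x·w)_v − (y·z)_v ∈ ℤ ∪ {±∞}. -/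
noncomputable def crv (G : SimpleGraph V) (v : V) (x y z w : Set (Set V)) : EReal :=
  toE (grom G v x z) + toE (grom G v y w) - toE (grom G v x w) - toE (grom G v y z)

/-- The triple of sums of Gromov products attached to a 4-tuple. -/
noncomputable def tripod (G : SimpleGraph V) (v : V) (x y z w : Set (Set V)) :
    ℕ∞ × ℕ∞ × ℕ∞ :=
  (grom G v x y + grom G v z w, grom G v x z + grom G v y w, grom G v x w + grom G v y z)

/-- (x,y,z,w) ∈ 𝒜 w.r.t. the basepoint v: at most one of the three sums is infinite. -/
def inA (G : SimpleGraph V) (v : V) (x y z w : Set (Set V)) : Prop :=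
  ((tripod G v x y z w).1 ≠ ⊤ ∧ (tripod G v x y z w).2.1 ≠ ⊤) ∨
  ((tripod G v x y z w).1 ≠ ⊤ ∧ (tripod G v x y z w).2.2 ≠ ⊤) ∨
  ((tripod G v x y z w).2.1 ≠ ⊤ ∧ (tripod G v x y z w).2.2 ≠ ⊤)

/-- (x,y,z,w) ∈ 𝒜 (this is independent of the basepoint). -/
def memA (G : SimpleGraph V) (x y z w : Set (Set V)) : Prop :=
  ∀ v : V, inA G v x y z w

/-- Two triples in (ℕ ∪ {+∞})³ are equivalent if they differ by adding a constant
n ∈ ℕ to all three entries. -/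
def TripEquiv (p q : ℕ∞ × ℕ∞ × ℕ∞) : Prop :=
  (∃ n : ℕ, p.1 = q.1 + (n : ℕ∞) ∧ p.2.1 = q.2.1 + (n : ℕ∞) ∧ p.2.2 = q.2.2 + (n : ℕ∞)) ∨
  (∃ n : ℕ, q.1 = p.1 + (n : ℕ∞) ∧ q.2.1 = p.2.1 + (n : ℕ∞) ∧ q.2.2 = p.2.2 + (n : ℕ∞))

/-- crt(x,y,z,w) = ⟪a:b:c⟫ (the cross ratio triple is independent of the basepoint,
so we require the equality of classes at every basepoint). -/
def crtEq (G : SimpleGraph V) (x y z w : Set (Set V)) (a b c : ℕ∞) : Prop :=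
  ∀ v : V, TripEquiv (tripod G v x y z w) (a, b, c)

/-- The median of three points of X̄. -/
def med (x y z : Set (Set V)) : Set (Set V) := (x ∩ y) ∪ (y ∩ z) ∪ (z ∩ x)

/-- The interval I(x,y) ⊆ X̄ between two points of X̄. -/
def rInterval (G : SimpleGraph V) (x y : Set (Set V)) : Set (Set (Set V)) :=
  {σ : Set (Set V) | IsUltra G σ ∧ x ∩ y ⊆ σ}

/-- `Op G x y z` : x and y are opposite with respect to z, i.e. the median
m = m(x,y,z) lies in X and I(x,y) = I(x,m) ∪ I(m,y). -/
def Op (G : SimpleGraph V) (x y z : Set (Set V)) : Prop :=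
  (∃ p : V, med x y z = princ G p) ∧
  rInterval G x y = rInterval G x (med x y z) ∪ rInterval G (med x y z) y

/-- A geodesic ray (based at `r 0`). -/
def IsGeodRay (G : SimpleGraph V) (r : ℕ → V) : Prop :=
  (∀ n : ℕ, G.Adj (r n) (r (n + 1))) ∧
  ∀ m n : ℕ, m ≤ n → G.dist (r m) (r n) = n - m

/-- A bi-infinite geodesic line. -/
def IsGeodLine (G : SimpleGraph V) (L : ℤ → V) : Prop :=
  (∀ n : ℤ, G.Adj (L n) (L (n + 1))) ∧
  ∀ m n : ℤ, m ≤ n → (G.dist (L m) (L n) : ℤ) = n - m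

/-- The set 𝒲(r) of hyperplanes crossed by (the edges of) a ray. -/
def rayWalls (G : SimpleGraph V) (r : ℕ → V) : Set (Set (Set V)) :=
  {W : Set (Set V) | ∃ n : ℕ, W = wallOf G (r n) (r (n + 1))}

/-- A hyperplane is adjacent to `v` if it is dual to an edge incident to `v`. -/
def WallAdjTo (G : SimpleGraph V) (v : V) (W : Set (Set V)) : Prop :=
  ∃ u : V, G.Adj v u ∧ W = wallOf G v u

/-- A straight ray: no two of the hyperplanes it crosses are transverse. -/
def RayStraight (G : SimpleGraph V) (r : ℕ → V) : Prop :=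
  ∀ m n : ℕ, ¬ Transv (edgeHalf G (r m) (r (m + 1))) (edgeHalf G (r n) (r (n + 1)))

/-- A straight line: no two of the hyperplanes it crosses are transverse. -/
def LineStraight (G : SimpleGraph V) (L : ℤ → V) : Prop :=
  ∀ m n : ℤ, ¬ Transv (edgeHalf G (L m) (L (m + 1))) (edgeHalf G (L n) (L (n + 1)))

/-- The endpoint at infinity r⁺ ∈ ∂X of a ray: the ultrafilter of those halfspaces
containing all but finitely many of its vertices. -/
def rayEnd (G : SimpleGraph V) (r : ℕ → V) : Set (Set V) :=
  {h : Set V | IsHalfspace G h ∧ ∃ N : ℕ, ∀ n : ℕ, N ≤ n → r n ∈ h}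

/-- A straight point of the Roller boundary: the endpoint at infinity of a straight ray. -/
def IsStraightPt (G : SimpleGraph V) (x : Set (Set V)) : Prop :=
  ∃ r : ℕ → V, IsGeodRay G r ∧ RayStraight G r ∧ rayEnd G r = x

/-- x and y are the two endpoints at infinity of the line L. -/
def LineEnds (G : SimpleGraph V) (L : ℤ → V) (x y : Set (Set V)) : Prop :=
  rayEnd G (fun n : ℕ => L (n : ℤ)) = x ∧ rayEnd G (fun n : ℕ => L (-(n : ℤ))) = y

/-- The edges from `v` to `a` and from `v` to `b` span a square. -/
def SpansSquare (G : SimpleGraph V) (v a b : V) : Prop :=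
  ∃ w : V, w ≠ v ∧ G.Adj a w ∧ G.Adj b w

/-- An extremal vertex: some edge at `v` spans a square with every other edge at `v`. -/
def Extremal (G : SimpleGraph V) (v : V) : Prop :=
  ∃ a : V, G.Adj v a ∧ ∀ b : V, G.Adj v b → b ≠ a → SpansSquare G v a b

/-- The cube complex has no extremal vertices. -/
def NoExtremal (G : SimpleGraph V) : Prop := ∀ v : V, ¬ Extremal G v

/-- A skinny vertex: exactly two incident edges. -/
def Skinny (G : SimpleGraph V) (v : V) : Prop := {u : V | G.Adj v u}.encard = 2

/-- A skinny ray: a geodesic ray whose initial vertex has at least three incident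
edges and all of whose other vertices are skinny. -/
def IsSkinnyRay (G : SimpleGraph V) (r : ℕ → V) : Prop :=
  IsGeodRay G r ∧ 3 ≤ {u : V | G.Adj (r 0) u}.encard ∧ ∀ n : ℕ, 1 ≤ n → Skinny G (r n)

/-- (The vertex set of) a cube of the complex: a subset inducing a hypercube graph. -/
def IsCube (G : SimpleGraph V) (c : Set V) : Prop :=
  ∃ (n : ℕ) (e : c ≃ (Fin n → Bool)),
    ∀ a b : c, G.Adj (a : V) (b : V) ↔ ∃! i : Fin n, e a i ≠ e b i

/-- A maximal cube. -/
def IsMaxCube (G : SimpleGraph V) (c : Set V) : Prop :=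
  IsCube G c ∧ ∀ c' : Set V, IsCube G c' → c ⊆ c' → c' = c

/-- Completeness: there is no infinite ascending chain of cubes. -/
def CubeComplete (G : SimpleGraph V) : Prop :=
  ¬ ∃ c : ℕ → Set V, (∀ n : ℕ, IsCube G (c n)) ∧ ∀ n : ℕ, c n ⊂ c (n + 1)

/-- No free faces: no non-maximal cube is contained in a unique maximal cube. -/
def NoFreeFaces (G : SimpleGraph V) : Prop :=
  ∀ c : Set V, IsCube G c → ¬ IsMaxCube G c → ¬ ∃! m : Set V, IsMaxCube G m ∧ c ⊆ m

/-- #𝒲(x, z | y, w): the number of hyperplanes separating x and z from y and w,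
counted through the sides containing x and z. -/
noncomputable def sepCount (x z y w : Set (Set V)) : ℕ∞ :=
  {h : Set V | h ∈ x ∧ h ∈ z ∧ h ∉ y ∧ h ∉ w}.encard

/-- A Möbius map between Roller boundaries: it maps 𝒜(X) into 𝒜(Y) and preserves
cross ratios. -/
def Mobius (G : SimpleGraph V) (G' : SimpleGraph V') (f : Bdry G → Bdry G') : Prop :=
  ∀ x y z w : Bdry G, memA G x.1 y.1 z.1 w.1 →
    memA G' (f x).1 (f y).1 (f z).1 (f w).1 ∧
    ∀ (v : V) (v' : V'),
      crv G' v' (f x).1 (f y).1 (f z).1 (f w).1 = crv G v x.1 y.1 z.1 w.1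

/-- The induced action of a cubical isomorphism on X̄: an ultrafilter is mapped to
the set of images of its halfspaces. -/
def mapUltra (φ : V → V') (σ : Set (Set V)) : Set (Set V') :=
  (fun h : Set V => φ '' h) '' σ

/-- The standard cubulation of ℝ: vertex set ℤ, edges between consecutive integers. -/
def zline : SimpleGraph ℤ := SimpleGraph.fromRel (fun m n => n = m + 1)

end CCCR

namespace CCCR

section Aux

variable {V : Type*} {G : SimpleGraph V}

lemma ax_tri (hG : IsCCC G) (a b c : V) : G.dist a c ≤ G.dist a b + G.dist b c :=
  hG.1.dist_triangle

lemma ax_adj {a b : V} (h : G.Adj a b) : G.dist a b = 1 :=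
  SimpleGraph.dist_eq_one_iff_adj.mpr h

lemma ax_med (hG : IsCCC G) (a b c : V) : ∃ m : V,
    G.dist a m + G.dist m b = G.dist a b ∧ G.dist b m + G.dist m c = G.dist b c ∧
    G.dist c m + G.dist m a = G.dist c a := by
  obtain ⟨m, hm, -⟩ := hG.2 a b c
  exact ⟨m, hm⟩

lemma ax_med_unique (hG : IsCCC G) {a b c m m' : V}
    (h1 : G.dist a m + G.dist m b = G.dist a b) (h2 : G.dist b m + G.dist m c = G.dist b c)
    (h3 : G.dist c m + G.dist m a = G.dist c a)
    (h1' : G.dist a m' + G.dist m' b = G.dist a b)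
    (h2' : G.dist b m' + G.dist m' c = G.dist b c)
    (h3' : G.dist c m' + G.dist m' a = G.dist c a) : m = m' :=
  (hG.2 a b c).unique ⟨h1, h2, h3⟩ ⟨h1', h2', h3'⟩

/-- Distances to the two ends of an edge differ by exactly one. -/
lemma ax_bip (hG : IsCCC G) {u v : V} (h : G.Adj u v) (w : V) :
    G.dist w v = G.dist w u + 1 ∨ G.dist w u = G.dist w v + 1 := by
  obtain ⟨m, h1, h2, h3⟩ := ax_med hG w u v
  have huv := ax_adj h
  have hvu := ax_adj h.symm
  have hc := SimpleGraph.dist_comm (G := G) (u := u) (v := m)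
  have hc2 := SimpleGraph.dist_comm (G := G) (u := w) (v := m)
  have hc3 := SimpleGraph.dist_comm (G := G) (u := v) (v := m)
  have hc4 := SimpleGraph.dist_comm (G := G) (u := v) (v := w)
  omega

lemma ax_mem {u v w : V} : w ∈ edgeHalf G u v ↔ G.dist w v < G.dist w u := Iff.rfl

lemma ax_self_mem {u v : V} (h : G.Adj u v) : v ∈ edgeHalf G u v := by
  rw [ax_mem, SimpleGraph.dist_self, ax_adj h.symm]; norm_num

lemma ax_self_notMem {u v : V} : u ∉ edgeHalf G u v := by
  rw [ax_mem, SimpleGraph.dist_self]; omega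

lemma ax_compl (hG : IsCCC G) {u v : V} (h : G.Adj u v) :
    (edgeHalf G u v)ᶜ = edgeHalf G v u := by
  ext w
  rw [mem_compl_iff, ax_mem, ax_mem]
  have := ax_bip hG h w
  omega

lemma ax_half {u v : V} (h : G.Adj u v) : IsHalfspace G (edgeHalf G u v) := ⟨u, v, h, rfl⟩

lemma ax_half_compl (hG : IsCCC G) {j : Set V} (h : IsHalfspace G j) : IsHalfspace G jᶜ := by
  obtain ⟨u, v, huv, rfl⟩ := h
  exact ⟨v, u, huv.symm, ax_compl hG huv⟩

/-- Halfspaces are convex. -/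
lemma ax_convex (hG : IsCCC G) {j : Set V} (hj : IsHalfspace G j) {w w' t : V}
    (hw : w ∈ j) (hw' : w' ∈ j) (ht : G.dist w t + G.dist t w' = G.dist w w') : t ∈ j := by
  obtain ⟨u, v, huv, rfl⟩ := hj
  by_contra htj
  simp only [mem_ofPred_eq] at hw hw' htj
  have b1 := ax_bip hG huv w
  have b2 := ax_bip hG huv w'
  have b3 := ax_bip hG huv t
  obtain ⟨a, a1, a2, a3⟩ := ax_med hG t w u
  obtain ⟨a', a1', a2', a3'⟩ := ax_med hG t w' u
  obtain ⟨c, c1, c2, c3⟩ := ax_med hG a a' u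
  obtain ⟨m, m1, m2, m3⟩ := ax_med hG w w' v
  have T := ax_tri hG
  have C : ∀ p q : V, G.dist p q = G.dist q p := fun p q => SimpleGraph.dist_comm
  have hcm : c = m := by
    refine ax_med_unique hG (a := w) (b := w') (c := u) ?_ ?_ ?_ m1 ?_ ?_
    · have := T w c w'
      have := T w a c
      have := T c a' w'
      have := T a t a'
      rw [C t a] at a1
      rw [C t w] at a1
      rw [C a w] at a1
      have := C a t
      omega
    · have := T w' c u
      have := T w' a' c
      have := C w' u
      have := C w' a'
      have := C a' u
      have := C c u
      omega
    · have := T u c w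
      have := T c a w
      have := C w u
      have := C w a
      have := C a u
      have := C c u
      have := C a c
      omega
    · have := T w' m u
      have := T m v u
      have := ax_adj huv.symm
      omega
    · have := T u m w
      have := T u v m
      have := ax_adj huv
      have := C u w
      have := C v w
      have := C v m
      omega
  subst hcm
  have := T t c v
  have := T t a c
  have := T w c u
  have := T t c u
  have := C t u
  have := C a u
  have := C a t
  have := C c u
  have := C c a
  have := C c w
  have := C c v
  have := C v w
  omega

/-- The halfspace separating two adjacent vertices is unique. -/
lemma ax_unique (hG : IsCCC G) {j : Set V} (hj : IsHalfspace G j) {u v : V} (h : G.Adj u v)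
    (hu : u ∉ j) (hv : v ∈ j) : j = edgeHalf G u v := by
  have huv := ax_adj h
  have hvu := ax_adj h.symm
  ext w
  constructor
  · intro hw
    by_contra hc
    rw [ax_mem] at hc
    have := ax_bip hG h w
    exact hu (ax_convex hG hj hw hv (by omega))
  · intro hw
    by_contra hc
    rw [ax_mem] at hw
    have := ax_bip hG h w
    exact (ax_convex hG (ax_half_compl hG hj) hc hu (by omega : G.dist w v + G.dist v u = _)) hv

lemma ax_step (hG : IsCCC G) {v q : V} (h : v ≠ q) :
    ∃ v', G.Adj v v' ∧ G.dist v' q + 1 = G.dist v q := by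
  obtain ⟨p, hp⟩ := hG.1.exists_walk_length_eq_dist v q
  cases p with
  | nil => exact absurd rfl h
  | @cons _ v' _ ha p =>
    refine ⟨v', ha, ?_⟩
    have h1 := SimpleGraph.dist_le p
    have h2 := ax_tri hG v v' q
    have h3 := ax_adj ha
    rw [SimpleGraph.Walk.length_cons] at hp
    omega

/-- Gates in halfspaces. -/
lemma ax_gate (hG : IsCCC G) {j : Set V} (hj : IsHalfspace G j) (v : V) :
    ∃ q ∈ j, ∀ w ∈ j, G.dist v q + G.dist q w = G.dist v w := by
  have hne : j.Nonempty := by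
    obtain ⟨a, b, hab, rfl⟩ := hj
    exact ⟨b, ax_self_mem hab⟩
  obtain ⟨q, hq, hmin⟩ : ∃ q ∈ j, ∀ w ∈ j, G.dist v q ≤ G.dist v w := by
    have hw := (measure (fun w => G.dist v w)).wf
    refine ⟨hw.min j hne, hw.min_mem j hne, fun w hwj => ?_⟩
    have := hw.not_lt_min j hwj
    exact not_lt.mp this
  refine ⟨q, hq, fun w hw => ?_⟩
  obtain ⟨m, m1, m2, m3⟩ := ax_med hG v q w
  have hm : m ∈ j := ax_convex hG hj hq hw m2
  have := hmin m hm
  have h0 : G.dist m q = 0 := by omega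
  rw [hG.1.dist_eq_zero_iff] at h0
  subst h0
  have C : ∀ p q : V, G.dist p q = G.dist q p := fun p q => SimpleGraph.dist_comm
  rw [C w m, C w v, C m v] at m3
  omega

/-- One step towards a gate. -/
lemma ax_gate_step (hG : IsCCC G) {j : Set V} {v q : V}
    (hq : ∀ w ∈ j, G.dist v q + G.dist q w = G.dist v w) (hne : v ≠ q) :
    ∃ v', G.Adj v v' ∧ G.dist v' q + 1 = G.dist v q ∧ j ⊆ edgeHalf G v v' ∧
      ∀ w ∈ j, G.dist v' q + G.dist q w = G.dist v' w := by
  obtain ⟨v', ha, hd⟩ := ax_step hG hne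
  have h1 := ax_adj ha
  refine ⟨v', ha, hd, fun w hw => ?_, fun w hw => ?_⟩
  · rw [ax_mem]
    have := hq w hw
    have := ax_tri hG v' q w
    have h2 := SimpleGraph.dist_comm (G := G) (u := v') (v := w)
    have h3 := SimpleGraph.dist_comm (G := G) (u := v) (v := w)
    omega
  · have := hq w hw
    have := ax_tri hG v' q w
    have := ax_tri hG v v' w
    omega

/-- Adjacent intersecting halfspaces span a square. -/
lemma ax_square (hG : IsCCC G) {v a b q : V} (ha : G.Adj v a) (hb : G.Adj v b) (hab : a ≠ b)
    (hqa : q ∈ edgeHalf G v a) (hqb : q ∈ edgeHalf G v b) :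
    ∃ c, c ≠ v ∧ G.Adj a c ∧ G.Adj b c ∧ edgeHalf G a c = edgeHalf G v b ∧
      edgeHalf G b c = edgeHalf G v a := by
  have C : ∀ p q : V, G.dist p q = G.dist q p := fun p q => SimpleGraph.dist_comm
  obtain ⟨c, c1, c2, c3⟩ := ax_med hG a b q
  have hca : c ∈ edgeHalf G v a :=
    ax_convex hG (ax_half ha) hqa (ax_self_mem ha) c3
  have hcb : c ∈ edgeHalf G v b :=
    ax_convex hG (ax_half hb) (ax_self_mem hb) hqb c2
  have hva := ax_adj ha
  have hvb := ax_adj hb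
  have hpos : 0 < G.dist a b := hG.1.pos_dist_of_ne hab
  have hanb : a ∉ edgeHalf G v b := by
    rw [ax_mem, C a v]; omega
  have hbna : b ∉ edgeHalf G v a := by
    rw [ax_mem, C b v, C b a]; omega
  have hle := ax_tri hG a v b
  have h1 : a ≠ c := fun h => hanb (h ▸ hcb)
  have h2 : b ≠ c := fun h => hbna (h ▸ hca)
  have p1 := hG.1.pos_dist_of_ne h1
  have p2 := hG.1.pos_dist_of_ne h2
  have e1 := C a v
  have e2 := C b c
  have hac : G.Adj a c := SimpleGraph.dist_eq_one_iff_adj.mp (by omega)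
  have hbc : G.Adj b c := SimpleGraph.dist_eq_one_iff_adj.mp (by omega)
  refine ⟨c, fun h => ax_self_notMem (h ▸ hca), hac, hbc, ?_, ?_⟩
  · exact (ax_unique hG (ax_half hb) hac hanb hcb).symm
  · exact (ax_unique hG (ax_half ha) hbc hbna hca).symm

lemma ax_nonext (hG : IsCCC G) (hne : NoExtremal G) {v a : V} (ha : G.Adj v a) :
    ∃ b, G.Adj v b ∧ b ≠ a ∧ edgeHalf G v a ∩ edgeHalf G v b = ∅ := by
  have := hne v
  unfold Extremal at this
  push Not at this
  obtain ⟨b, hb, hba, hsq⟩ := this a ha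
  refine ⟨b, hb, hba, ?_⟩
  by_contra hc
  obtain ⟨q, hq1, hq2⟩ := nonempty_iff_ne_empty.mpr hc
  obtain ⟨c, h1, h2, h3, -⟩ := ax_square hG ha hb hba.symm hq1 hq2
  exact hsq ⟨c, h1, h2, h3⟩

/-! ### Ultrafilters -/

lemma ul_up {x : Set (Set V)} (hx : IsUltra G x) {j k : Set V}
    (hj : j ∈ x) (hk : IsHalfspace G k) (h : j ⊆ k) : k ∈ x := by
  rw [hx.2.1 k hk]
  intro hc
  obtain ⟨q, h1, h2⟩ := hx.2.2 j hj _ hc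
  exact h2 (h h1)

lemma ul_compl {x : Set (Set V)} (hx : IsUltra G x) {j : Set V}
    (hj : IsHalfspace G j) (h : j ∉ x) : jᶜ ∈ x := by
  by_contra hc
  exact h ((hx.2.1 j hj).mpr hc)

lemma ul_not {x : Set (Set V)} (hx : IsUltra G x) {j : Set V}
    (h : j ∈ x) : jᶜ ∉ x := (hx.2.1 j (hx.1 j h)).mp h

/-- A straight ray with prescribed initial edge gives a boundary point. -/
lemma ax_ray (hG : IsCCC G) (hne : NoExtremal G) {u v : V} (h : G.Adj u v) :
    ∃ z, IsBdryPt G z ∧ edgeHalf G u v ∈ z ∧ ∀ j ∈ z, u ∉ j → j ⊆ edgeHalf G u v := by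
  classical
  have hnext : ∀ e : {e : V × V // G.Adj e.1 e.2}, ∃ b, G.Adj e.1.2 b ∧
      edgeHalf G e.1.2 b ⊆ edgeHalf G e.1.1 e.1.2 := by
    rintro ⟨⟨a, b⟩, hab⟩
    obtain ⟨c, hc, -, hd⟩ := ax_nonext hG hne hab.symm
    refine ⟨c, hc, fun w hw => ?_⟩
    by_contra hw2
    have : w ∈ (edgeHalf G a b)ᶜ := hw2
    rw [ax_compl hG hab] at this
    have h3 : w ∈ edgeHalf G b a ∩ edgeHalf G b c := ⟨this, hw⟩
    rw [hd] at h3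
    exact h3
  choose nx hnx1 hnx2 using hnext
  let F : ℕ → {e : V × V // G.Adj e.1 e.2} := fun n =>
    Nat.rec ⟨(u, v), h⟩ (fun _ e => ⟨(e.1.2, nx e), hnx1 e⟩) n
  let r : ℕ → V := fun n => (F n).1.1
  have hr1 : ∀ n, r (n + 1) = (F n).1.2 := fun n => rfl
  have hadj : ∀ n, G.Adj (r n) (r (n + 1)) := fun n => (F n).2
  let g : ℕ → Set V := fun n => edgeHalf G (r n) (r (n + 1))
  have hanti : Antitone g := antitone_nat_of_succ_le fun n => hnx2 (F n)
  have hin : ∀ m n, n < m → r m ∈ g n := by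
    intro m n hmn
    obtain ⟨k, rfl⟩ : ∃ k, m = k + 1 := ⟨m - 1, by omega⟩
    exact hanti (Nat.lt_succ_iff.mp hmn) (ax_self_mem (hadj k))
  -- crossing lemma
  have hcross : ∀ j, IsHalfspace G j → ∀ m n, m ≤ n → r m ∉ j → r n ∈ j →
      ∃ k, m ≤ k ∧ j = g k := by
    intro j hj m n hmn hm hn
    induction n, hmn using Nat.le_induction with
    | base => exact absurd hn hm
    | succ k hk ih =>
      by_cases hkj : r k ∈ j
      · exact ih hkj
      · exact ⟨k, hk, ax_unique hG hj (hadj k) hkj hn⟩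
  have hgz : ∀ n, g n ∈ rayEnd G r := fun n =>
    ⟨ax_half (hadj n), n + 1, fun m hm => hin m n (by omega)⟩
  have hultra : IsUltra G (rayEnd G r) := by
    refine ⟨fun j hj => hj.1, fun j hj => ⟨?_, ?_⟩, ?_⟩
    · rintro ⟨-, N, hN⟩ ⟨-, N', hN'⟩
      exact hN' (max N N') (le_max_right _ _) (hN _ (le_max_left _ _))
    · intro hc
      by_contra hc2
      have h1 : ∀ N, ∃ n, N ≤ n ∧ r n ∉ j := by
        intro N
        by_contra h1
        push Not at h1
        exact hc2 ⟨hj, N, h1⟩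
      have h2 : ∀ N, ∃ n, N ≤ n ∧ r n ∈ j := by
        intro N
        by_contra h1
        push Not at h1
        exact hc ⟨ax_half_compl hG hj, N, h1⟩
      obtain ⟨n1, -, hn1⟩ := h1 0
      obtain ⟨n2, h12, hn2⟩ := h2 n1
      obtain ⟨k, -, rfl⟩ := hcross j hj n1 n2 h12 hn1 hn2
      exact hc2 (hgz k)
    · rintro j ⟨-, N, hN⟩ k ⟨-, N', hN'⟩
      exact ⟨r (max N N'), hN _ (le_max_left _ _), hN' _ (le_max_right _ _)⟩
  refine ⟨rayEnd G r, ⟨hultra, fun p hp => ?_⟩, hgz 0, fun j hj huj => ?_⟩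
  · have hd : ∀ n, G.dist p (r (n + 1)) < G.dist p (r n) := by
      intro n
      have := hgz n
      rw [hp] at this
      exact this.2
    have hd2 : ∀ n, G.dist p (r n) + n ≤ G.dist p (r 0) := by
      intro n
      induction n with
      | zero => simp
      | succ n ih => have := hd n; omega
    have := hd2 (G.dist p (r 0) + 1)
    omega
  · obtain ⟨hjh, N, hN⟩ := hj
    obtain ⟨k, -, rfl⟩ := hcross j hjh 0 N (Nat.zero_le _) huj (hN N le_rfl)
    exact hanti (Nat.zero_le k)

/-! ### Independence of the basepoint -/

lemma grom_comm (v : V) (x y : Set (Set V)) : grom G v x y = grom G v y x := by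
  unfold grom
  congr 1
  ext j
  simp only [mem_ofPred_eq]
  tauto

open Classical in
lemma grom_split (hG : IsCCC G) {x y : Set (Set V)} (hx : IsUltra G x)
    {v v' : V} (h : G.Adj v v') :
    grom G v x y = {j : Set V | j ∈ x ∧ j ∈ y ∧ v ∉ j ∧ v' ∉ j}.encard +
      (if edgeHalf G v v' ∈ x ∧ edgeHalf G v v' ∈ y then 1 else 0) := by
  have hself := ax_self_mem h
  have hself' : v ∉ edgeHalf G v v' := ax_self_notMem
  split_ifs with hc
  · have : {j : Set V | j ∈ x ∧ j ∈ y ∧ v ∉ j} =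
        insert (edgeHalf G v v') {j : Set V | j ∈ x ∧ j ∈ y ∧ v ∉ j ∧ v' ∉ j} := by
      ext j
      simp only [mem_ofPred_eq, mem_insert_iff]
      constructor
      · rintro ⟨h1, h2, h3⟩
        by_cases h4 : v' ∈ j
        · exact Or.inl (ax_unique hG (hx.1 j h1) h h3 h4)
        · exact Or.inr ⟨h1, h2, h3, h4⟩
      · rintro (rfl | h1)
        · exact ⟨hc.1, hc.2, hself'⟩
        · exact ⟨h1.1, h1.2.1, h1.2.2.1⟩
    unfold grom
    rw [this, encard_insert_of_notMem]
    rintro ⟨-, -, -, h4⟩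
    exact h4 hself
  · rw [add_zero]
    unfold grom
    congr 1
    ext j
    simp only [mem_ofPred_eq]
    constructor
    · rintro ⟨h1, h2, h3⟩
      refine ⟨h1, h2, h3, fun h4 => ?_⟩
      have := ax_unique hG (hx.1 j h1) h h3 h4
      subst this
      exact hc ⟨h1, h2⟩
    · rintro ⟨h1, h2, h3, -⟩
      exact ⟨h1, h2, h3⟩

/-- Auxiliary equivalence on triples. -/
def TE (p q : ℕ∞ × ℕ∞ × ℕ∞) : Prop :=
  ∃ m n : ℕ, p.1 + (m : ℕ∞) = q.1 + (n : ℕ∞) ∧ p.2.1 + (m : ℕ∞) = q.2.1 + (n : ℕ∞) ∧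
    p.2.2 + (m : ℕ∞) = q.2.2 + (n : ℕ∞)

lemma TE_trans {p q r : ℕ∞ × ℕ∞ × ℕ∞} (h1 : TE p q) (h2 : TE q r) : TE p r := by
  obtain ⟨m, n, a1, a2, a3⟩ := h1
  obtain ⟨m', n', b1, b2, b3⟩ := h2
  have key : ∀ a b c : ℕ∞, a + (m : ℕ∞) = b + (n : ℕ∞) → b + (m' : ℕ∞) = c + (n' : ℕ∞) →
      a + ((m + m' : ℕ) : ℕ∞) = c + ((n' + n : ℕ) : ℕ∞) := by
    intro a b c h h'
    push_cast
    rw [← add_assoc, h, ← add_assoc, ← h', add_right_comm]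
  exact ⟨m + m', n' + n, key _ _ _ a1 b1, key _ _ _ a2 b2, key _ _ _ a3 b3⟩

lemma TE_imp {p q : ℕ∞ × ℕ∞ × ℕ∞} (h : TE p q) : TripEquiv p q := by
  obtain ⟨m, n, a1, a2, a3⟩ := h
  have key : ∀ (a b : ℕ∞) (m n : ℕ), m ≤ n → a + (m : ℕ∞) = b + (n : ℕ∞) →
      a = b + ((n - m : ℕ) : ℕ∞) := by
    intro a b m n hmn h
    obtain ⟨k, rfl⟩ := Nat.exists_eq_add_of_le hmn
    rw [Nat.add_sub_cancel_left]
    push_cast at h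
    rw [add_comm (m : ℕ∞) k, ← add_assoc] at h
    exact ENat.add_left_injective_of_ne_top (ENat.natCast_ne_top m) h
  rcases le_total m n with hmn | hmn
  · exact Or.inl ⟨n - m, key _ _ _ _ hmn a1, key _ _ _ _ hmn a2, key _ _ _ _ hmn a3⟩
  · exact Or.inr ⟨m - n, key _ _ _ _ hmn a1.symm, key _ _ _ _ hmn a2.symm,
      key _ _ _ _ hmn a3.symm⟩

lemma TE_step (hG : IsCCC G) {x y z w : Set (Set V)} (hx : IsUltra G x) (hy : IsUltra G y)
    (hz : IsUltra G z) (hw : IsUltra G w) {v v' : V} (h : G.Adj v v') :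
    TE (tripod G v x y z w) (tripod G v' x y z w) := by
  classical
  have e : ∀ a b : Set (Set V), {j : Set V | j ∈ a ∧ j ∈ b ∧ v' ∉ j ∧ v ∉ j} =
      {j : Set V | j ∈ a ∧ j ∈ b ∧ v ∉ j ∧ v' ∉ j} := by
    intro a b; ext j; simp only [mem_ofPred_eq]; tauto
  have hc : ∀ a, IsUltra G a → (edgeHalf G v' v ∈ a ↔ edgeHalf G v v' ∉ a) := by
    intro a ha
    rw [← ax_compl hG h, ha.2.1 _ (ax_half h), not_not]
  unfold TE tripod
  simp only [grom_split hG hx h, grom_split hG hy h, grom_split hG hz h,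
    grom_split hG hx h.symm, grom_split hG hy h.symm, grom_split hG hz h.symm, e,
    hc x hx, hc y hy, hc z hz, hc w hw]
  generalize {j : Set V | j ∈ x ∧ j ∈ y ∧ v ∉ j ∧ v' ∉ j}.encard = r1
  generalize {j : Set V | j ∈ z ∧ j ∈ w ∧ v ∉ j ∧ v' ∉ j}.encard = r2
  generalize {j : Set V | j ∈ x ∧ j ∈ z ∧ v ∉ j ∧ v' ∉ j}.encard = r3
  generalize {j : Set V | j ∈ y ∧ j ∈ w ∧ v ∉ j ∧ v' ∉ j}.encard = r4
  generalize {j : Set V | j ∈ x ∧ j ∈ w ∧ v ∉ j ∧ v' ∉ j}.encard = r5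
  generalize {j : Set V | j ∈ y ∧ j ∈ z ∧ v ∉ j ∧ v' ∉ j}.encard = r6
  have t1 : ∀ a b : ℕ∞, a + 1 + (b + 1) = a + b + 2 := by
    intro a b
    rw [show (2 : ℕ∞) = 1 + 1 by norm_num]; abel
  have t2 : ∀ a b : ℕ∞, a + 1 + b = a + b + 1 := by intro a b; abel
  by_cases h1 : edgeHalf G v v' ∈ x <;> by_cases h2 : edgeHalf G v v' ∈ y <;>
    by_cases h3 : edgeHalf G v v' ∈ z <;> by_cases h4 : edgeHalf G v v' ∈ w <;>
    simp only [h1, h2, h3, h4, and_self, and_true, true_and, and_false, false_and,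
      not_true, not_false_iff, if_true, if_false, add_zero, t1, t2, ← add_assoc]
  all_goals first
    | (refine ⟨0, 0, ?_⟩; simp; done)
    | (refine ⟨0, 1, ?_⟩; simp; done)
    | (refine ⟨1, 0, ?_⟩; simp; done)
    | (refine ⟨0, 2, ?_⟩; simp; done)
    | (refine ⟨2, 0, ?_⟩; simp; done)

lemma crtEq_self (hG : IsCCC G) {x y z w : Set (Set V)} (hx : IsUltra G x) (hy : IsUltra G y)
    (hz : IsUltra G z) (hw : IsUltra G w) (v0 : V) :
    crtEq G x y z w (tripod G v0 x y z w).1 (tripod G v0 x y z w).2.1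
      (tripod G v0 x y z w).2.2 := by
  intro v
  refine TE_imp ?_
  obtain ⟨p⟩ := hG.1.preconnected v v0
  induction p with
  | nil => exact ⟨0, 0, rfl, rfl, rfl⟩
  | cons ha p ih => exact TE_trans (TE_step hG hx hy hz hw ha) ih

lemma TripEquiv_lt {p : ℕ∞ × ℕ∞ × ℕ∞} {a b c : ℕ∞} (h : TripEquiv p (a, b, c))
    (h1 : a < min b c) (h2 : min b c < ⊤) : p.1 < min p.2.1 p.2.2 ∧ min p.2.1 p.2.2 < ⊤ := by
  obtain ⟨p1, p2, p3⟩ := p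
  rcases h with ⟨n, e1, e2, e3⟩ | ⟨n, e1, e2, e3⟩
  · simp only at e1 e2 e3
    subst e1 e2 e3
    simp only [lt_min_iff, min_lt_iff] at *
    have hn := ENat.natCast_ne_top n
    refine ⟨⟨(ENat.add_lt_add_iff_right hn).mpr h1.1, (ENat.add_lt_add_iff_right hn).mpr h1.2⟩, ?_⟩
    rcases h2 with h2 | h2
    · exact Or.inl (WithTop.add_lt_top.mpr ⟨h2, ENat.natCast_lt_top n⟩)
    · exact Or.inr (WithTop.add_lt_top.mpr ⟨h2, ENat.natCast_lt_top n⟩)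
  · simp only at e1 e2 e3
    subst e1 e2 e3
    simp only [lt_min_iff, min_lt_iff] at *
    have hn := ENat.natCast_ne_top n
    refine ⟨⟨(ENat.add_lt_add_iff_right hn).mp h1.1, (ENat.add_lt_add_iff_right hn).mp h1.2⟩, ?_⟩
    rcases h2 with h2 | h2
    · exact Or.inl (WithTop.add_lt_top.mp h2).1
    · exact Or.inr (WithTop.add_lt_top.mp h2).1

/-! ### From a straight line to the cross ratio condition -/

lemma int_transition {P : ℤ → Prop} {m n : ℤ} (hmn : m ≤ n) (hm : ¬ P m) (hn : P n) :
    ∃ k, ¬ P k ∧ P (k + 1) := by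
  induction n, hmn using Int.le_induction with
  | base => exact absurd hn hm
  | succ k hk ih =>
    by_cases h : P k
    · exact ih h
    · exact ⟨k, h, hn⟩

lemma line_mem {L : ℤ → V} (hL : IsGeodLine G L) (m n : ℤ) :
    L m ∈ edgeHalf G (L n) (L (n + 1)) ↔ n < m := by
  rw [ax_mem]
  rcases lt_or_ge n m with h | h
  · have h1 := hL.2 n m h.le
    have h2 := hL.2 (n + 1) m h
    rw [SimpleGraph.dist_comm] at h1 h2
    simp only [h, iff_true]
    omega
  · have h1 := hL.2 m n h
    have h2 := hL.2 m (n + 1) (by omega)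
    have : ¬ n < m := not_lt.mpr h
    simp only [this, iff_false]
    omega

lemma forward (hG : IsCCC G) {x y : Set (Set V)} (hx : IsUltra G x) (hy : IsUltra G y)
    {L : ℤ → V} (hL : IsGeodLine G L) (hs : LineStraight G L) (he : LineEnds G L x y) :
    (∃ p : V, princ G p ∈ rInterval G x y) ∧
        ¬ ∃ (z w : Set (Set V)) (a b c : ℕ∞), IsBdryPt G z ∧ IsBdryPt G w ∧
          crtEq G x y z w a b c ∧ a < min b c ∧ min b c < ⊤ := by
  let g : ℤ → Set V := fun n => edgeHalf G (L n) (L (n + 1))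
  have hgm : ∀ m n, L m ∈ g n ↔ n < m := line_mem hL
  have hgh : ∀ n, IsHalfspace G (g n) := fun n => ax_half (hL.1 n)
  have hanti : ∀ m n, m ≤ n → g n ⊆ g m := by
    intro m n hmn
    rcases hmn.eq_or_lt with rfl | hlt
    · exact subset_rfl
    intro q hq
    by_contra hq2
    refine hs m n ⟨⟨L (n + 1), ?_, ?_⟩, ⟨L (m + 1), ?_, ?_⟩, ⟨q, hq2, hq⟩, ⟨L m, ?_, ?_⟩⟩
    · exact (hgm _ _).mpr (by omega)
    · exact (hgm _ _).mpr (by omega)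
    · exact (hgm _ _).mpr (by omega)
    · exact fun h => absurd ((hgm _ _).mp h) (by omega)
    · exact fun h => absurd ((hgm _ _).mp h) (by omega)
    · exact fun h => absurd ((hgm _ _).mp h) (by omega)
  have hgx : ∀ n, g n ∈ x := by
    intro n
    rw [← he.1]
    refine ⟨hgh n, n.toNat + 1, fun m hm => (hgm _ _).mpr (by omega)⟩
  have hgy : ∀ n, (g n)ᶜ ∈ y := by
    intro n
    rw [← he.2]
    refine ⟨ax_half_compl hG (hgh n), (-n).toNat + 1, fun m hm h => ?_⟩
    have := (hgm _ _).mp h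
    omega
  have hginj : Function.Injective g := by
    intro a b hab
    by_contra hne
    rcases lt_or_gt_of_ne hne with h | h
    · have h1 := (hgm b a).mpr h
      rw [hab] at h1
      have := (hgm b b).mp h1
      omega
    · have h1 := (hgm a b).mpr h
      rw [← hab] at h1
      have := (hgm a a).mp h1
      omega
  have hxmem : ∀ j ∈ x, ∀ m : ℤ, ∃ n : ℤ, m ≤ n ∧ L n ∈ j := by
    intro j hj m
    rw [← he.1] at hj
    obtain ⟨-, N, hN⟩ := hj
    exact ⟨((max N m.toNat : ℕ) : ℤ), by omega, hN _ (le_max_left _ _)⟩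
  have hymem : ∀ j ∈ y, ∀ m : ℤ, ∃ n : ℤ, n ≤ m ∧ L n ∈ j := by
    intro j hj m
    rw [← he.2] at hj
    obtain ⟨-, N, hN⟩ := hj
    exact ⟨-((max N (-m).toNat : ℕ) : ℤ), by omega, hN _ (le_max_left _ _)⟩
  have hboth : ∀ j, j ∈ x → j ∈ y → ∀ m, L m ∈ j := by
    intro j h1 h2 m
    obtain ⟨n, hn, hnj⟩ := hxmem j h1 m
    obtain ⟨n', hn', hnj'⟩ := hymem j h2 m
    refine ax_convex hG (hx.1 j h1) hnj' hnj ?_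
    have e1 := hL.2 n' m hn'
    have e2 := hL.2 m n hn
    have e3 := hL.2 n' n (by omega)
    omega
  have hxny : ∀ j, j ∈ x → j ∉ y → ∃ n, j = g n := by
    intro j h1 h2
    have hjh := hx.1 j h1
    obtain ⟨n, hn, hnj⟩ := hxmem j h1 0
    obtain ⟨n', hn', hnj'⟩ := hymem _ (ul_compl hy hjh h2) 0
    obtain ⟨k, hk1, hk2⟩ := int_transition (P := fun k => L k ∈ j) (by omega : n' ≤ n) hnj' hnj
    exact ⟨k, ax_unique hG hjh (hL.1 k) hk1 hk2⟩
  have hynx : ∀ j, j ∈ y → j ∉ x → ∃ n, j = (g n)ᶜ := by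
    intro j h1 h2
    have h3 := ul_compl hx (hy.1 j h1) h2
    obtain ⟨n, hn⟩ := hxny _ h3 (ul_not hy h1)
    exact ⟨n, by rw [← hn, compl_compl]⟩
  refine ⟨⟨L 0, ⟨⟨fun j hj => hj.1, fun j hj => ⟨fun h h' => h'.2 h.2, fun h => ⟨hj, ?_⟩⟩,
    fun j hj k hk => ⟨L 0, hj.2, hk.2⟩⟩, fun j hj => ⟨hx.1 j hj.1, hboth j hj.1 hj.2 0⟩⟩⟩, ?_⟩
  · by_contra hc
    exact h ⟨ax_half_compl hG hj, hc⟩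
  rintro ⟨z, w, a, b, c, hz, hw, hcrt, hlt, hfin⟩
  have hT : ∀ v, (tripod G v x y z w).1 < min (tripod G v x y z w).2.1 (tripod G v x y z w).2.2 ∧
      min (tripod G v x y z w).2.1 (tripod G v x y z w).2.2 < ⊤ :=
    fun v => TripEquiv_lt (hcrt v) hlt hfin
  clear hcrt hlt hfin
  have down : ∀ u, IsUltra G u → ∀ m n, m ≤ n → g n ∈ u → g m ∈ u :=
    fun u hu m n hmn h => ul_up hu h (hgh m) (hanti m n hmn)
  -- vanishing of sums
  have van : ∀ (z w : Set (Set V)), IsUltra G z → IsUltra G w → ∀ m : ℤ,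
      (∀ n, g n ∈ z → n < m) → (∀ n, g n ∉ w → m ≤ n) →
      grom G (L m) x z + grom G (L m) y w = 0 := by
    intro z w hz hw m h1 h2
    have e1 : grom G (L m) x z = 0 := by
      unfold grom
      rw [encard_eq_zero, eq_empty_iff_forall_notMem]
      rintro j ⟨hjx, hjz, hjv⟩
      by_cases hjy : j ∈ y
      · exact hjv (hboth j hjx hjy m)
      · obtain ⟨n, rfl⟩ := hxny j hjx hjy
        exact hjv ((hgm _ _).mpr (h1 n hjz))
    have e2 : grom G (L m) y w = 0 := by
      unfold grom
      rw [encard_eq_zero, eq_empty_iff_forall_notMem]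
      rintro j ⟨hjy, hjw, hjv⟩
      by_cases hjx : j ∈ x
      · exact hjv (hboth j hjx hjy m)
      · obtain ⟨n, rfl⟩ := hynx j hjy hjx
        have := h2 n (fun h => ul_not hw h hjw)
        have h3 : ¬ n < m := by omega
        exact hjv (fun h => h3 ((hgm _ _).mp h))
    rw [e1, e2, add_zero]
  have topx : ∀ z, (∀ n, g n ∈ z) → grom G (L 0) x z = ⊤ := by
    intro z hz
    unfold grom
    rw [encard_eq_top_iff]
    refine infinite_of_injective_forall_mem (f := fun n : ℕ => g n) ?_ ?_
    · intro a b hab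
      exact_mod_cast hginj hab
    · intro n
      exact ⟨hgx _, hz _, fun h => absurd ((hgm _ _).mp h) (by omega)⟩
  have topy : ∀ z, IsUltra G z → (∀ n, g n ∉ z) → grom G (L 0) y z = ⊤ := by
    intro z hzu hz
    unfold grom
    rw [encard_eq_top_iff]
    refine infinite_of_injective_forall_mem (f := fun n : ℕ => (g (-(n : ℤ) - 1))ᶜ) ?_ ?_
    · intro a b hab
      have := hginj (compl_injective hab)
      omega
    · intro n
      exact ⟨hgy _, ul_compl hzu (hgh _) (hz _), fun h => h ((hgm _ _).mpr (by omega))⟩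
  -- main argument
  have main : ∀ (z w : Set (Set V)), IsUltra G z → IsUltra G w →
      (∀ n, g n ∈ z → g n ∈ w) →
      (∃ m, grom G (L m) x z + grom G (L m) y w = 0) ∨
      (grom G (L 0) x z = ⊤ ∧ grom G (L 0) x w = ⊤) ∨
      (grom G (L 0) y z = ⊤ ∧ grom G (L 0) y w = ⊤) := by
    intro z w hz hw hzw
    by_cases hZ : ∀ n, g n ∈ z
    · exact Or.inr (Or.inl ⟨topx z hZ, topx w fun n => hzw n (hZ n)⟩)
    by_cases hW : ∀ n, g n ∉ w
    · exact Or.inr (Or.inr ⟨topy z hz fun n h => hW n (hzw n h), topy w hw hW⟩)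
    left
    push Not at hZ hW
    by_cases hd : ∃ m, g m ∈ w ∧ g m ∉ z
    · obtain ⟨m, hm1, hm2⟩ := hd
      refine ⟨m, van z w hz hw m (fun n hn => ?_) (fun n hn => ?_)⟩
      · by_contra hc
        exact hm2 (down z hz m n (by omega) hn)
      · by_contra hc
        exact hn (down w hw n m (by omega) hm1)
    · push Not at hd
      obtain ⟨a, ha⟩ := hZ
      obtain ⟨b, hb⟩ := hW
      have hb' := hd b hb
      have hba : b ≤ a := by
        by_contra hc
        exact ha (down z hz a b (by omega) hb')
      obtain ⟨k, hk1, hk2⟩ := int_transition (P := fun k => g k ∉ z) hba (not_not.mpr hb') ha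
      have hk1' : g k ∈ z := not_not.mp hk1
      refine ⟨k + 1, van z w hz hw _ (fun n hn => ?_) (fun n hn => ?_)⟩
      · by_contra hc
        exact hk2 (down z hz _ n (by omega) hn)
      · by_contra hc
        exact hn (hzw _ (down z hz n k (by omega) hk1'))
  have comp : (∀ n, g n ∈ z → g n ∈ w) ∨ (∀ n, g n ∈ w → g n ∈ z) := by
    by_contra hc
    push Not at hc
    obtain ⟨⟨m, hm1, hm2⟩, ⟨n, hn1, hn2⟩⟩ := hc
    rcases le_total m n with h | h
    · exact hm2 (down w hw.1 m n h hn1)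
    · exact hn2 (down z hz.1 n m h hm1)
  rcases comp with hzw | hzw
  · rcases main z w hz.1 hw.1 hzw with ⟨m, hm⟩ | ⟨h1, h2⟩ | ⟨h1, h2⟩
    · have := (lt_min_iff.mp (hT (L m)).1).1
      simp [tripod, hm] at this
    · have := (hT (L 0)).2
      simp [tripod, h1, h2] at this
    · have := (hT (L 0)).2
      simp [tripod, h1, h2] at this
  · rcases main w z hw.1 hz.1 hzw with ⟨m, hm⟩ | ⟨h1, h2⟩ | ⟨h1, h2⟩
    · have := (lt_min_iff.mp (hT (L m)).1).2
      simp [tripod, hm] at this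
    · have := (hT (L 0)).2
      simp [tripod, h1, h2] at this
    · have := (hT (L 0)).2
      simp [tripod, h1, h2] at this

/-! ### The converse -/

lemma square_bad (hG : IsCCC G) (hne : NoExtremal G) {x y : Set (Set V)} (hx : IsUltra G x)
    (hy : IsUltra G y) {v a b : V} (hv : ∀ j ∈ x, j ∈ y → v ∈ j)
    (ha : G.Adj v a) (hb : G.Adj v b) (hax : edgeHalf G v a ∈ x) (hbx : edgeHalf G v b ∈ x)
    (hab : a ≠ b) :
    ∃ z w, IsBdryPt G z ∧ IsBdryPt G w ∧
      grom G v x y + grom G v z w = 0 ∧ grom G v x z + grom G v y w = 1 ∧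
      1 ≤ grom G v x w + grom G v y z := by
  obtain ⟨q, hqa, hqb⟩ := hx.2.2 _ hax _ hbx
  obtain ⟨c, hcv, hac, hbc, e1, e2⟩ := ax_square hG ha hb hab hqa hqb
  have hva := ax_adj ha
  have hvb := ax_adj hb
  have hpos : 0 < G.dist a b := hG.1.pos_dist_of_ne hab
  have hanb : a ∉ edgeHalf G v b := by
    rw [ax_mem, SimpleGraph.dist_comm (u := a) (v := v)]; omega
  have hbna : b ∉ edgeHalf G v a := by
    rw [ax_mem, SimpleGraph.dist_comm (u := b) (v := v),
      SimpleGraph.dist_comm (u := b) (v := a)]; omega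
  obtain ⟨a', haa', -, hdisj⟩ := ax_nonext hG hne hac
  rw [e1] at hdisj
  obtain ⟨z, hz, -, hz2⟩ := ax_ray hG hne haa'
  obtain ⟨w, hw, hbw, hw2⟩ := ax_ray hG hne hb
  have hbny : edgeHalf G v b ∉ y := fun h => ax_self_notMem (hv _ hbx h)
  have haz : edgeHalf G v a ∈ z := by
    by_contra hc
    have h1 := hz2 _ (ul_compl hz.1 (ax_half ha) hc) (not_not.mpr (ax_self_mem ha))
    have h2 : b ∈ edgeHalf G v b ∩ edgeHalf G a a' := ⟨ax_self_mem hb, h1 hbna⟩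
    rw [hdisj] at h2
    exact h2
  have haw : edgeHalf G v a ∉ w := by
    intro h
    exact hanb (hw2 _ h ax_self_notMem (ax_self_mem ha))
  have hzv : ∀ j ∈ z, v ∉ j → j = edgeHalf G v a ∨ edgeHalf G v b ∩ j = ∅ := by
    intro j hj hvj
    by_cases haj : a ∈ j
    · exact Or.inl (ax_unique hG (hz.1.1 j hj) ha hvj haj)
    · right
      rw [← subset_empty_iff, ← hdisj]
      exact inter_subset_inter_right _ (hz2 j hj haj)
  have g1 : grom G v x y = 0 := by
    unfold grom
    rw [encard_eq_zero, eq_empty_iff_forall_notMem]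
    rintro j ⟨h1, h2, h3⟩
    exact h3 (hv j h1 h2)
  have g2 : grom G v z w = 0 := by
    unfold grom
    rw [encard_eq_zero, eq_empty_iff_forall_notMem]
    rintro j ⟨h1, h2, h3⟩
    rcases hzv j h1 h3 with rfl | h4
    · exact haw h2
    · exact (hw.1.2.2 _ hbw _ h2).ne_empty h4
  have g3 : grom G v x z = 1 := by
    unfold grom
    rw [encard_eq_one]
    refine ⟨edgeHalf G v a, ?_⟩
    ext j
    constructor
    · rintro ⟨h1, h2, h3⟩
      rcases hzv j h2 h3 with h4 | h4
      · exact h4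
      · exact absurd h4 (hx.2.2 _ hbx _ h1).ne_empty
    · rintro rfl
      exact ⟨hax, haz, ax_self_notMem⟩
  have g4 : grom G v y w = 0 := by
    unfold grom
    rw [encard_eq_zero, eq_empty_iff_forall_notMem]
    rintro j ⟨h1, h2, h3⟩
    exact hbny (ul_up hy h1 (ax_half hb) (hw2 j h2 h3))
  have g5 : 1 ≤ grom G v x w := by
    unfold grom
    rw [one_le_encard_iff_nonempty]
    exact ⟨edgeHalf G v b, hbx, hbw, ax_self_notMem⟩
  refine ⟨z, w, hz, hw, by rw [g1, g2, add_zero], by rw [g3, g4, add_zero], ?_⟩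
  exact g5.trans le_self_add

lemma exists_succ (hG : IsCCC G) {x y : Set (Set V)} (hx : IsBdryPt G x) {v : V}
    (hv : ∀ j ∈ x, j ∈ y → v ∈ j) :
    ∃ v', (∀ j ∈ x, j ∈ y → v' ∈ j) ∧ G.Adj v v' ∧ edgeHalf G v v' ∈ x := by
  obtain ⟨j, hj, hvj⟩ : ∃ j ∈ x, v ∉ j := by
    by_contra hc
    push Not at hc
    refine hx.2 v (Subset.antisymm (fun j hj => ⟨hx.1.1 j hj, hc j hj⟩) ?_)
    rintro j ⟨hj, hvj⟩
    by_contra hjx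
    exact hc _ (ul_compl hx.1 hj hjx) hvj
  obtain ⟨q, hqj, hq⟩ := ax_gate hG (hx.1.1 j hj) v
  obtain ⟨v', ha, -, hsub, -⟩ := ax_gate_step hG hq (fun h => hvj (h ▸ hqj))
  have hmem := ul_up hx.1 hj (ax_half ha) hsub
  refine ⟨v', fun k hk hky => ?_, ha, hmem⟩
  by_contra hc
  have hkc : kᶜ = edgeHalf G v v' :=
    ax_unique hG (ax_half_compl hG (hx.1.1 k hk)) ha (not_not.mpr (hv k hk hky)) hc
  rw [← hkc] at hmem
  exact ul_not hx.1 hk hmem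

lemma backward (hG : IsCCC G) {x y : Set (Set V)} (hx : IsBdryPt G x)
    (hy : IsBdryPt G y) {p : V} (hp : ∀ j ∈ x, j ∈ y → p ∈ j)
    (hux : ∀ v a b, (∀ j ∈ x, j ∈ y → v ∈ j) → G.Adj v a → G.Adj v b →
      edgeHalf G v a ∈ x → edgeHalf G v b ∈ x → a = b)
    (huy : ∀ v a b, (∀ j ∈ x, j ∈ y → v ∈ j) → G.Adj v a → G.Adj v b →
      edgeHalf G v a ∈ y → edgeHalf G v b ∈ y → a = b) :
    ∃ L : ℤ → V, IsGeodLine G L ∧ LineStraight G L ∧ LineEnds G L x y := by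
  let M := {v : V // ∀ j ∈ x, j ∈ y → v ∈ j}
  have h1 : ∀ v : M, ∃ v' : M, G.Adj v.1 v'.1 ∧ edgeHalf G v.1 v'.1 ∈ x := by
    intro v
    obtain ⟨v', h1, h2, h3⟩ := exists_succ hG hx v.2
    exact ⟨⟨v', h1⟩, h2, h3⟩
  have h2 : ∀ v : M, ∃ v' : M, G.Adj v.1 v'.1 ∧ edgeHalf G v.1 v'.1 ∈ y := by
    intro v
    obtain ⟨v', h1, h2, h3⟩ := exists_succ (y := x) hG hy (fun j h h' => v.2 j h' h)
    exact ⟨⟨v', fun j h h' => h1 j h' h⟩, h2, h3⟩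
  choose s hs1 hs2 using h1
  choose t ht1 ht2 using h2
  have flipx : ∀ (v : M) (u : V), G.Adj v.1 u → edgeHalf G v.1 u ∈ x → edgeHalf G u v.1 ∈ y := by
    intro v u hvu h
    rw [← ax_compl hG hvu]
    exact ul_compl hy.1 (ax_half hvu) (fun h' => ax_self_notMem (v.2 _ h h'))
  have flipy : ∀ (v : M) (u : V), G.Adj v.1 u → edgeHalf G v.1 u ∈ y → edgeHalf G u v.1 ∈ x := by
    intro v u hvu h
    rw [← ax_compl hG hvu]
    exact ul_compl hx.1 (ax_half hvu) (fun h' => ax_self_notMem (v.2 _ h' h))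
  have hst : ∀ v, s (t v) = v := fun v => Subtype.ext
    (hux (t v).1 _ _ (t v).2 (hs1 _) (ht1 v).symm (hs2 _) (flipy v _ (ht1 v) (ht2 v)))
  have hts : ∀ v, t (s v) = v := fun v => Subtype.ext
    (huy (s v).1 _ _ (s v).2 (ht1 _) (hs1 v).symm (ht2 _) (flipx v _ (hs1 v) (hs2 v)))
  let S : Equiv.Perm M := ⟨s, t, hts, hst⟩
  let l : ℤ → M := fun n => (S ^ n) ⟨p, hp⟩
  have hl : ∀ n, l (n + 1) = s (l n) := by
    intro n
    change (S ^ (n + 1)) _ = S ((S ^ n) _)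
    rw [add_comm, zpow_one_add]
    rfl
  have hl' : ∀ n, l (n - 1) = t (l n) := by
    intro n
    have := hl (n - 1)
    rw [sub_add_cancel] at this
    rw [this, hts]
  let L : ℤ → V := fun n => (l n).1
  have hadj : ∀ n, G.Adj (L n) (L (n + 1)) := by
    intro n
    change G.Adj (l n).1 (l (n + 1)).1
    rw [hl]; exact hs1 _
  let g : ℤ → Set V := fun n => edgeHalf G (L n) (L (n + 1))
  have hgx : ∀ n, g n ∈ x := by
    intro n
    change edgeHalf G (l n).1 (l (n + 1)).1 ∈ x
    rw [hl]; exact hs2 _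
  have hgy : ∀ n, g n ∉ y := fun n h => ax_self_notMem ((l n).2 _ (hgx n) h)
  have stayx : ∀ j ∈ x, ∀ m n, m ≤ n → L m ∈ j → L n ∈ j := by
    intro j hj m n hmn hm
    induction n, hmn using Int.le_induction with
    | base => exact hm
    | succ k hk ih =>
      by_contra hc
      have := ax_unique hG (ax_half_compl hG (hx.1.1 j hj)) (hadj k) (not_not.mpr ih) hc
      exact ul_not hx.1 hj (this ▸ hgx k)
  have stayy : ∀ j ∈ y, ∀ m n, m ≤ n → L n ∈ j → L m ∈ j := by
    intro j hj m n hmn hn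
    by_contra hc
    obtain ⟨k, hk1, hk2⟩ := int_transition (P := fun k => L k ∈ j) hmn hc hn
    have := ax_unique hG (hy.1.1 j hj) (hadj k) hk1 hk2
    rw [this] at hj
    exact hgy k hj
  have hgeo : IsGeodLine G L := by
    refine ⟨hadj, fun m n hmn => ?_⟩
    induction n, hmn using Int.le_induction with
    | base => simp
    | succ k hk ih =>
      have h1 : L m ∉ g k := fun h => ax_self_notMem (stayx _ (hgx k) m k hk h)
      have h2 : ¬ G.dist (L m) (L (k + 1)) < G.dist (L m) (L k) := h1
      have := ax_bip hG (hadj k) (L m)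
      omega
  have hgm : ∀ m n, L m ∈ g n ↔ n < m := line_mem hgeo
  have hnest : ∀ n, g (n + 1) ⊆ g n := by
    intro n q hq
    by_contra hq2
    have hq3 : q ∈ (g n)ᶜ := hq2
    change q ∈ (edgeHalf G (L n) (L (n + 1)))ᶜ at hq3
    rw [ax_compl hG (hadj n)] at hq3
    have hne : L n ≠ L (n + 1 + 1) := by
      intro h
      have h1 := (hgm (n + 1 + 1) n).mpr (by omega)
      rw [← h] at h1
      exact ax_self_notMem h1
    obtain ⟨c, hc, hac, -, e1, -⟩ := ax_square hG (hadj n).symm (hadj (n + 1)) hne hq3 hq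
    have hcx : edgeHalf G (L n) c ∈ x := by rw [e1]; exact hgx (n + 1)
    exact hc (hux (L n) c (L (n + 1)) (l n).2 hac (hadj n) hcx (hgx n))
  have hanti : ∀ m n, m ≤ n → g n ⊆ g m := by
    intro m n hmn
    induction n, hmn using Int.le_induction with
    | base => exact subset_rfl
    | succ k hk ih => exact (hnest k).trans ih
  have reachx : ∀ j ∈ x, ∀ q ∈ j, ∀ (N : ℕ) (n : ℤ), G.dist (L n) q = N →
      (∀ w ∈ j, G.dist (L n) q + G.dist q w = G.dist (L n) w) → ∃ m, L m ∈ j := by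
    intro j hj q hq N
    induction N with
    | zero =>
      intro n hn _
      rw [hG.1.dist_eq_zero_iff] at hn
      exact ⟨n, hn ▸ hq⟩
    | succ N ih =>
      intro n hn hgate
      have hne : L n ≠ q := by
        intro h
        rw [h, SimpleGraph.dist_self] at hn
        omega
      obtain ⟨v', ha, hd, hsub, hg'⟩ := ax_gate_step hG hgate hne
      have hv' : v' = L (n + 1) := hux (L n) _ _ (l n).2 ha (hadj n)
        (ul_up hx.1 hj (ax_half ha) hsub) (hgx n)
      subst hv'
      exact ih (n + 1) (by omega) hg'
  have reachy : ∀ j ∈ y, ∀ q ∈ j, ∀ (N : ℕ) (n : ℤ), G.dist (L n) q = N →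
      (∀ w ∈ j, G.dist (L n) q + G.dist q w = G.dist (L n) w) → ∃ m, L m ∈ j := by
    intro j hj q hq N
    induction N with
    | zero =>
      intro n hn _
      rw [hG.1.dist_eq_zero_iff] at hn
      exact ⟨n, hn ▸ hq⟩
    | succ N ih =>
      intro n hn hgate
      have hne : L n ≠ q := by
        intro h
        rw [h, SimpleGraph.dist_self] at hn
        omega
      obtain ⟨v', ha, hd, hsub, hg'⟩ := ax_gate_step hG hgate hne
      have e : L (n - 1) = (t (l n)).1 := congrArg Subtype.val (hl' n)
      have hv' : v' = L (n - 1) := by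
        rw [e]
        exact huy (L n) _ _ (l n).2 ha (ht1 (l n))
          (ul_up hy.1 hj (ax_half ha) hsub) (ht2 (l n))
      subst hv'
      exact ih (n - 1) (by omega) hg'
  have endx : ∀ j ∈ x, ∃ N : ℕ, ∀ n : ℕ, N ≤ n → L (n : ℤ) ∈ j := by
    intro j hj
    obtain ⟨q, hqj, hq⟩ := ax_gate hG (hx.1.1 j hj) (L 0)
    obtain ⟨m, hm⟩ := reachx j hj q hqj _ 0 rfl hq
    exact ⟨m.toNat, fun n hn => stayx j hj m n (by omega) hm⟩
  have endy : ∀ j ∈ y, ∃ N : ℕ, ∀ n : ℕ, N ≤ n → L (-(n : ℤ)) ∈ j := by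
    intro j hj
    obtain ⟨q, hqj, hq⟩ := ax_gate hG (hy.1.1 j hj) (L 0)
    obtain ⟨m, hm⟩ := reachy j hj q hqj _ 0 rfl hq
    exact ⟨(-m).toNat, fun n hn => stayy j hj _ m (by omega) hm⟩
  have ends : ∀ (r : ℕ → V) (x : Set (Set V)), IsUltra G x →
      (∀ j ∈ x, ∃ N : ℕ, ∀ n : ℕ, N ≤ n → r n ∈ j) → rayEnd G r = x := by
    intro r x hx h
    apply Subset.antisymm
    · rintro j ⟨hj, N, hN⟩
      by_contra hc
      obtain ⟨N', hN'⟩ := h _ (ul_compl hx hj hc)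
      exact hN' (max N N') (le_max_right _ _) (hN _ (le_max_left _ _))
    · exact fun j hj => ⟨hx.1 j hj, h j hj⟩
  refine ⟨L, hgeo, fun m n hT => ?_, ends _ x hx.1 endx, ends _ y hy.1 endy⟩
  obtain ⟨-, ⟨q1, h1, h1'⟩, ⟨q2, h2, h2'⟩, -⟩ := hT
  rcases le_total m n with h | h
  · exact h2 (hanti m n h h2')
  · exact h1' (hanti n m h h1)

end Aux

end CCCR

open CCCR
/-- Lemma `invariance of straight geodesics`: two boundary
points `x, y` are the endpoints at infinity of a straight line if and only if
(1) `I(x,y) ∩ X ≠ ∅` and (2) there are no boundary points `z, w` with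
`crt(x,y,z,w) = ⟪a:b:c⟫` and `a < min{b,c} < +∞`. -/
theorem stmt12 {V : Type*} (G : SimpleGraph V) (hG : IsCCC G) (hne : NoExtremal G)
    (x y : Set (Set V)) (hx : IsBdryPt G x) (hy : IsBdryPt G y) :
    (∃ L : ℤ → V, IsGeodLine G L ∧ LineStraight G L ∧ LineEnds G L x y) ↔
      ((∃ p : V, princ G p ∈ rInterval G x y) ∧
        ¬ ∃ (z w : Set (Set V)) (a b c : ℕ∞), IsBdryPt G z ∧ IsBdryPt G w ∧
          crtEq G x y z w a b c ∧ a < min b c ∧ min b c < ⊤) := by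
  constructor
  · rintro ⟨L, h1, h2, h3⟩
    exact forward hG hx.1 hy.1 h1 h2 h3
  · rintro ⟨⟨p, hp⟩, hno⟩
    have hp' : ∀ j ∈ x, j ∈ y → p ∈ j := fun j h h' => (hp.2 ⟨h, h'⟩).2
    refine backward hG hx hy hp' ?_ ?_
    · intro v a b hv ha hb hax hbx
      by_contra hab
      obtain ⟨z, w, hz, hw, e1, e2, e3⟩ := square_bad hG hne hx.1 hy.1 hv ha hb hax hbx hab
      refine hno ⟨z, w, _, _, _, hz, hw, crtEq_self hG hx.1 hy.1 hz.1 hw.1 v, ?_, ?_⟩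
      · simp only [tripod, e1, e2, lt_min_iff]
        exact ⟨zero_lt_one, lt_of_lt_of_le zero_lt_one e3⟩
      · simp only [tripod, e2, min_lt_iff]
        exact Or.inl (ENat.natCast_lt_top 1)
    · intro v a b hv ha hb hax hbx
      by_contra hab
      obtain ⟨z, w, hz, hw, e1, e2, e3⟩ := square_bad hG hne hy.1 hx.1
        (fun j h h' => hv j h' h) ha hb hax hbx hab
      rw [grom_comm v y x] at e1
      rw [add_comm] at e2 e3
      refine hno ⟨z, w, _, _, _, hz, hw, crtEq_self hG hx.1 hy.1 hz.1 hw.1 v, ?_, ?_⟩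
      · simp only [tripod, e1, e2, lt_min_iff]
        exact ⟨lt_of_lt_of_le zero_lt_one e3, zero_lt_one⟩
      · simp only [tripod, e2, min_lt_iff]
        exact Or.inr (ENat.natCast_lt_top 1)
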